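/- arXiv:math/0502052 — 2 statements merged into one kernel-verified Lean document; each statement's English description precedes it below -/
import Mathlib

section
/- For integers k ≥ 1, a ≥ 2, b ≥ 2, and p = kab, the family f_s(x,y) = x^p − (y^a + s x^{ka−1})^b satisfies μ(f₀) − μ(f_s) = ab − b for small s ≠ 0, where f₀ = x^p − y^{ab}. -/
open MvPolynomial

/-- The local Milnor number at the origin of a plane curve germ given by a polynomial `f`:
the dimension over `ℂ` of `ℂ[[x,y]] / (∂f/∂x, ∂f/∂y)`. -/
noncomputable def milnor (f : MvPolynomial (Fin 2) ℂ) : ℕ :=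
  Module.finrank ℂ (MvPowerSeries (Fin 2) ℂ ⧸
    Ideal.span {((pderiv 0 f : MvPolynomial (Fin 2) ℂ) : MvPowerSeries (Fin 2) ℂ),
                ((pderiv 1 f : MvPolynomial (Fin 2) ℂ) : MvPowerSeries (Fin 2) ℂ)})

namespace MilnorAux

abbrev PS := MvPowerSeries (Fin 2) ℂ

/-- `F` is a nonzerodivisor modulo `H`. -/
def Reg (F H : PS) : Prop := ∀ α : PS, H ∣ α * F → H ∣ α

/-- The local intersection multiplicity, as a cardinal. -/
noncomputable def D (F H : PS) : Cardinal :=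
  Module.rank ℂ (PS ⧸ (Ideal.span {F, H} : Ideal PS))

lemma D_comm (F H : PS) : D F H = D H F := by
  unfold D; rw [Ideal.span_pair_comm]

lemma D_mul (F G H : PS) (hH : H ≠ 0) (h : Reg F H) : D F (G * H) = D F G + D F H := by
  let I : Ideal PS := Ideal.span {F, G}
  let J : Ideal PS := Ideal.span {F, G * H}
  let K : Ideal PS := Ideal.span {F, H}
  have hIJ : I ≤ Submodule.comap (LinearMap.mulLeft PS H) J := by
    intro z hz
    obtain ⟨u, v, rfl⟩ := Ideal.mem_span_pair.1 hz
    exact Ideal.mem_span_pair.2 ⟨H * u, v, by simp only [LinearMap.mulLeft_apply]; ring⟩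
  have hJK : J ≤ Submodule.comap (LinearMap.id (R := PS) (M := PS)) K := by
    intro z hz
    obtain ⟨u, v, rfl⟩ := Ideal.mem_span_pair.1 hz
    exact Ideal.mem_span_pair.2 ⟨u, v * G, by
      change _ = u * F + v * (G * H)
      ring⟩
  let i := (Submodule.mapQ I J (LinearMap.mulLeft PS H) hIJ).restrictScalars ℂ
  let q := (Submodule.mapQ J K LinearMap.id hJK).restrictScalars ℂ
  have hi : Function.Injective i := by
    rw [injective_iff_map_eq_zero]
    intro z hz
    obtain ⟨z, rfl⟩ := Submodule.Quotient.mk_surjective _ z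
    have hz' : H * z ∈ J := (Submodule.Quotient.mk_eq_zero J).1 hz
    obtain ⟨u, v, e⟩ := Ideal.mem_span_pair.1 hz'
    obtain ⟨w, rfl⟩ := h u ⟨z - v * G, by linear_combination e⟩
    refine (Submodule.Quotient.mk_eq_zero I).2 (Ideal.mem_span_pair.2 ⟨w, v, ?_⟩)
    apply mul_left_cancel₀ hH
    linear_combination e
  have hq : Function.Surjective q := by
    intro z
    obtain ⟨z, rfl⟩ := Submodule.Quotient.mk_surjective _ z
    exact ⟨Submodule.Quotient.mk z, rfl⟩
  have hex : LinearMap.ker q = LinearMap.range i := by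
    ext z
    obtain ⟨z, rfl⟩ := Submodule.Quotient.mk_surjective _ z
    constructor
    · intro hz
      have hz' : z ∈ K := (Submodule.Quotient.mk_eq_zero K).1 hz
      obtain ⟨u, v, e⟩ := Ideal.mem_span_pair.1 hz'
      refine ⟨Submodule.Quotient.mk v, (Submodule.Quotient.eq J).2 ?_⟩
      refine Ideal.mem_span_pair.2 ⟨-u, 0, ?_⟩
      simp only [LinearMap.mulLeft_apply]
      linear_combination -e
    · rintro ⟨w, hw⟩
      obtain ⟨w, rfl⟩ := Submodule.Quotient.mk_surjective _ w
      rw [← hw]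
      refine (Submodule.Quotient.mk_eq_zero K).2 (Ideal.mem_span_pair.2 ⟨0, w, ?_⟩)
      simp only [LinearMap.mulLeft_apply, LinearMap.id_apply]
      ring
  have h1 := LinearMap.rank_range_add_rank_ker q
  rw [hex, rank_range_of_surjective q hq, ← (LinearEquiv.ofInjective i hi).rank_eq] at h1
  rw [add_comm]
  exact h1.symm

lemma D_one (F : PS) : D F 1 = 0 := by
  unfold D
  have : (Ideal.span {F, 1} : Ideal PS) = ⊤ :=
    (Ideal.eq_top_iff_one _).2 (Ideal.subset_span (by simp))
  rw [this]
  have : Subsingleton (PS ⧸ (⊤ : Ideal PS)) := Ideal.Quotient.subsingleton_iff.2 rfl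
  exact rank_subsingleton' ℂ _

lemma D_mul_pow (F G H : PS) (hH : H ≠ 0) (h : Reg F H) (n : ℕ) :
    D F (G * H ^ n) = D F G + n * D F H := by
  induction n with
  | zero => simp
  | succ n ih =>
    rw [pow_succ, ← mul_assoc, D_mul _ _ _ hH h, ih]
    push_cast
    ring

lemma D_pow (F H : PS) (hH : H ≠ 0) (h : Reg F H) (n : ℕ) :
    D F (H ^ n) = n * D F H := by
  have := D_mul_pow F 1 H hH h n
  rwa [one_mul, D_one, zero_add] at this

lemma D_add_mul (F H c : PS) : D (F + H * c) H = D F H := by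
  unfold D; rw [Ideal.span_pair_add_right_mul]

lemma D_unit_mul (u F H : PS) (hu : IsUnit u) : D (u * F) H = D F H := by
  unfold D
  rw [Ideal.span_insert, Ideal.span_singleton_mul_left_unit hu, ← Ideal.span_insert]

lemma Reg.mul {F G H : PS} (h1 : Reg F H) (h2 : Reg G H) : Reg (F * G) H := by
  intro α hα
  apply h1
  apply h2
  rwa [mul_assoc]

lemma Reg.unit {u : PS} (H : PS) (hu : IsUnit u) : Reg u H := by
  intro α hα
  exact (IsUnit.dvd_mul_right hu).1 hα

lemma Reg.pow {F H : PS} (h1 : Reg F H) (n : ℕ) : Reg (F ^ n) H := by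
  induction n with
  | zero => exact Reg.unit _ (by simp)
  | succ n ih => rw [pow_succ]; exact ih.mul h1

lemma Reg.add_mul {F H : PS} (h : Reg F H) (c : PS) : Reg (F + H * c) H := by
  intro α hα
  apply h
  have : α * F = α * (F + H * c) - H * (α * c) := by ring
  rw [this]
  exact dvd_sub hα (dvd_mul_right _ _)

lemma Reg.symm {F H : PS} (hH : H ≠ 0) (h : Reg F H) : Reg H F := by
  rintro α ⟨c, hc⟩
  obtain ⟨d, rfl⟩ := h c ⟨α, by linear_combination -hc⟩
  refine ⟨d, mul_right_cancel₀ hH ?_⟩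
  linear_combination hc

/-- The variables. -/
noncomputable abbrev x : PS := MvPowerSeries.X 0
noncomputable abbrev y : PS := MvPowerSeries.X 1

lemma X_ne (i : Fin 2) : (MvPowerSeries.X i : PS) ≠ 0 := by
  intro h
  have := congrArg (MvPowerSeries.coeff (Finsupp.single i 1)) h
  simp [MvPowerSeries.coeff_X] at this

lemma reg_yx : Reg y x := by
  intro α hα
  rw [MvPowerSeries.X_dvd_iff] at hα ⊢
  intro m hm
  have := hα (m + Finsupp.single 1 1) (by simp [hm])
  have e : y = MvPowerSeries.monomial (Finsupp.single 1 1) 1 := rfl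
  rw [e, MvPowerSeries.coeff_add_mul_monomial, mul_one] at this
  exact this

lemma reg_xy : Reg x y := reg_yx.symm (X_ne 0)

lemma span_xy : (Ideal.span {x, y} : Ideal PS) =
    RingHom.ker (MvPowerSeries.constantCoeff (σ := Fin 2) (R := ℂ)) := by
  apply le_antisymm
  · rw [Ideal.span_le]
    rintro z (rfl | rfl) <;> simp
  · intro φ hφ
    rw [RingHom.mem_ker] at hφ
    let ψ : PS := fun n => if n 0 = 0 then MvPowerSeries.coeff n φ else 0
    have hψ : ∀ n, MvPowerSeries.coeff n ψ = if n 0 = 0 then MvPowerSeries.coeff n φ else 0 :=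
      fun n => rfl
    have h1 : x ∣ φ - ψ := by
      rw [MvPowerSeries.X_dvd_iff]
      intro m hm
      simp [hψ, hm]
    have h2 : y ∣ ψ := by
      rw [MvPowerSeries.X_dvd_iff]
      intro m hm
      rw [hψ]
      split_ifs with h0
      · have : m = 0 := by
          ext i; fin_cases i <;> simpa
        rw [this]
        simpa using hφ
      · rfl
    obtain ⟨u, hu⟩ := h1
    obtain ⟨v, hv⟩ := h2
    exact Ideal.mem_span_pair.2 ⟨u, v, by linear_combination -hu - hv⟩

lemma D_xy : D x y = 1 := by
  unfold D
  rw [span_xy]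
  have hs : Function.Surjective (MvPowerSeries.constantCoeff (σ := Fin 2) (R := ℂ)) :=
    fun c => ⟨MvPowerSeries.C c, by simp⟩
  let e := RingHom.quotientKerEquivOfSurjective hs
  let e' : (PS ⧸ RingHom.ker (MvPowerSeries.constantCoeff (σ := Fin 2) (R := ℂ))) ≃ₗ[ℂ] ℂ :=
    { e with
      map_smul' := by
        intro c z
        obtain ⟨z, rfl⟩ := Ideal.Quotient.mk_surjective z
        change MvPowerSeries.constantCoeff (c • z) = c • MvPowerSeries.constantCoeff z
        simp }
  rw [e'.rank_eq]
  simp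

lemma unit_C (c : ℂ) (hc : c ≠ 0) : IsUnit (MvPowerSeries.C c : PS) :=
  (isUnit_iff_ne_zero.2 hc).map MvPowerSeries.C

lemma D_zero (n m : ℕ) : D (x ^ n) (y ^ m) = ((n * m : ℕ) : Cardinal) := by
  rw [D_pow _ _ (X_ne 1) (reg_xy.pow n), D_comm, D_pow _ _ (X_ne 0) reg_yx, D_comm, D_xy]
  push_cast; ring

lemma milnor_eq (f : MvPolynomial (Fin 2) ℂ) (n : ℕ)
    (h : D ((pderiv 0 f : MvPolynomial (Fin 2) ℂ) : PS)
      ((pderiv 1 f : MvPolynomial (Fin 2) ℂ) : PS) = n) : milnor f = n :=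
  Module.finrank_eq_of_rank_eq h

lemma milnor_zero (p q : ℕ) (hp : p ≠ 0) (hq : q ≠ 0) :
    milnor ((X 0) ^ p - (X 1) ^ q) = (p - 1) * (q - 1) := by
  apply milnor_eq
  have h0 : ((pderiv 0 ((X 0) ^ p - (X 1) ^ q : MvPolynomial (Fin 2) ℂ)
      : MvPolynomial (Fin 2) ℂ) : PS) = MvPowerSeries.C (p : ℂ) * x ^ (p - 1) := by
    have : (pderiv 0 ((X 0) ^ p - (X 1) ^ q : MvPolynomial (Fin 2) ℂ))
      = C (p : ℂ) * X 0 ^ (p - 1) := by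
      simp [pderiv_X]
    rw [this]; push_cast; rfl
  have h1 : ((pderiv 1 ((X 0) ^ p - (X 1) ^ q : MvPolynomial (Fin 2) ℂ)
      : MvPolynomial (Fin 2) ℂ) : PS) = MvPowerSeries.C (-q : ℂ) * y ^ (q - 1) := by
    have : (pderiv 1 ((X 0) ^ p - (X 1) ^ q : MvPolynomial (Fin 2) ℂ))
      = C (-q : ℂ) * X 1 ^ (q - 1) := by
      simp [pderiv_X]
    rw [this]; push_cast; rfl
  rw [h0, h1, D_unit_mul _ _ _ (unit_C _ (by exact_mod_cast hp)), D_comm,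
    D_unit_mul _ _ _ (unit_C _ (by simpa using hq)), D_comm, D_zero]

lemma coe_sub' (f g : MvPolynomial (Fin 2) ℂ) : ((f - g : MvPolynomial (Fin 2) ℂ) : PS) = f - g :=
  map_sub (coeToMvPowerSeries.ringHom (σ := Fin 2) (R := ℂ)) f g

lemma milnor_s (m a b : ℕ) (hm : 1 ≤ m) (ha : 2 ≤ a) (hb : 2 ≤ b) (s : ℂ) (hs : s ≠ 0) :
    milnor ((X 0) ^ (m * b + b) - ((X 1) ^ a + C s * (X 0) ^ m) ^ b)
      = (b - 1) * ((m * b + b - 1) * a) + (a - 1) * (m * b - 1) := by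
  apply milnor_eq
  obtain ⟨m, rfl⟩ : ∃ n, m = n + 1 := ⟨m - 1, by omega⟩
  obtain ⟨a, rfl⟩ : ∃ n, a = n + 1 := ⟨a - 1, by omega⟩
  obtain ⟨b, rfl⟩ : ∃ n, b = n + 2 := ⟨b - 2, by omega⟩
  set g : PS := y ^ (a + 1) + MvPowerSeries.C s * x ^ (m + 1) with hg
  obtain ⟨P, hP⟩ : ∃ P, P = (m + 1) * (b + 2) + (b + 2) := ⟨_, rfl⟩
  obtain ⟨N, hN⟩ : ∃ N, N + 1 = (m + 1) * (b + 2) := ⟨(m + 1) * (b + 2) - 1, by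
    have : 0 < (m + 1) * (b + 2) := by positivity
    omega⟩
  have hPN : P = N + 1 + (b + 2) := by omega
  rw [← hP, ← hN]
  have h0 : ((pderiv 0 ((X 0) ^ P - ((X 1) ^ (a + 1) + C s * (X 0) ^ (m + 1)) ^ (b + 2)
      : MvPolynomial (Fin 2) ℂ) : MvPolynomial (Fin 2) ℂ) : PS)
      = MvPowerSeries.C (P : ℂ) * x ^ (P - 1)
        - MvPowerSeries.C ((b + 2 : ℕ) * (s * (m + 1 : ℕ)) : ℂ) * (g ^ (b + 1) * x ^ m) := by
    have : (pderiv 0 ((X 0) ^ P - ((X 1) ^ (a + 1) + C s * (X 0) ^ (m + 1)) ^ (b + 2)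
      : MvPolynomial (Fin 2) ℂ))
      = C (P : ℂ) * X 0 ^ (P - 1) - C ((b + 2 : ℕ) * (s * (m + 1 : ℕ)) : ℂ) *
        (((X 1) ^ (a + 1) + C s * (X 0) ^ (m + 1)) ^ (b + 1) * X 0 ^ m) := by
      simp [pderiv_X]
      try rw [show (C 2 : MvPolynomial (Fin 2) ℂ) = 2 from map_ofNat C 2]
      ring
    rw [this, hg]; simp only [coe_sub', coe_mul, coe_pow, coe_add, coe_C, coe_X]
  have h1 : ((pderiv 1 ((X 0) ^ P - ((X 1) ^ (a + 1) + C s * (X 0) ^ (m + 1)) ^ (b + 2)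
      : MvPolynomial (Fin 2) ℂ) : MvPolynomial (Fin 2) ℂ) : PS)
      = MvPowerSeries.C (-((b + 2 : ℕ) * (a + 1 : ℕ)) : ℂ) * (g ^ (b + 1) * y ^ a) := by
    have : (pderiv 1 ((X 0) ^ P - ((X 1) ^ (a + 1) + C s * (X 0) ^ (m + 1)) ^ (b + 2)
      : MvPolynomial (Fin 2) ℂ))
      = C (-((b + 2 : ℕ) * (a + 1 : ℕ)) : ℂ) *
        (((X 1) ^ (a + 1) + C s * (X 0) ^ (m + 1)) ^ (b + 1) * X 1 ^ a) := by
      simp [pderiv_X]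
      try rw [show (C 2 : MvPolynomial (Fin 2) ℂ) = 2 from map_ofNat C 2]
      ring
    rw [this, hg]; simp only [coe_sub', coe_mul, coe_pow, coe_add, coe_C, coe_X]
  rw [h0, h1, D_comm, D_unit_mul _ _ _ (unit_C _ ?_), D_comm]
  swap
  · rw [neg_ne_zero]
    exact_mod_cast (by positivity : (b + 2) * (a + 1) ≠ 0)
  have hP0 : (P : ℂ) ≠ 0 := by exact_mod_cast (by omega : P ≠ 0)
  set F : PS := MvPowerSeries.C (P : ℂ) * x ^ (P - 1)
        - MvPowerSeries.C ((b + 2 : ℕ) * (s * (m + 1 : ℕ)) : ℂ) * (g ^ (b + 1) * x ^ m) with hF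
  -- the branch `g`
  have hgx' : g = y ^ (a + 1) + x * (MvPowerSeries.C s * x ^ m) := by rw [hg]; ring
  have hgx : Reg g x := by
    rw [hgx']; exact (reg_yx.pow _).add_mul _
  have hxg : Reg x g := hgx.symm (X_ne 0)
  have hF1 : F = MvPowerSeries.C (P : ℂ) * x ^ (P - 1) + g *
      (-(MvPowerSeries.C ((b + 2 : ℕ) * (s * (m + 1 : ℕ)) : ℂ) * (g ^ b * x ^ m))) := by
    rw [hF]; ring
  have hFg : Reg F g := by
    rw [hF1]; exact ((Reg.unit _ (unit_C _ hP0)).mul (hxg.pow _)).add_mul _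
  have hDg : D F g = (((P - 1) * (a + 1) : ℕ) : Cardinal) := by
    rw [hF1, D_add_mul, D_unit_mul _ _ _ (unit_C _ hP0), D_comm, D_pow _ _ (X_ne 0) hgx, hgx',
      D_add_mul, D_comm, D_pow _ _ (X_ne 1) reg_xy, D_xy]
    push_cast; ring
  have hg0 : g ≠ 0 := by
    intro h
    rw [h] at hgx
    have := hgx 1 (by simp)
    rw [MvPowerSeries.X_dvd_iff] at this
    have := this 0 rfl
    simp at this
  -- the branch `y`
  obtain ⟨c, hc⟩ : y ∣ g ^ (b + 1) - (MvPowerSeries.C s * x ^ (m + 1)) ^ (b + 1) := by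
    refine dvd_trans ?_ (sub_dvd_pow_sub_pow _ _ _)
    refine ⟨y ^ a, ?_⟩
    rw [hg]; ring
  set u : PS := MvPowerSeries.C (P : ℂ) * x ^ (b + 2) -
    MvPowerSeries.C ((b + 2 : ℕ) * (s * (m + 1 : ℕ)) * s ^ (b + 1) : ℂ) with hu
  have hu1 : IsUnit u := by
    rw [MvPowerSeries.isUnit_iff_constantCoeff, isUnit_iff_ne_zero, hu]
    simp only [map_sub, map_mul, map_pow, MvPowerSeries.constantCoeff_C,
      MvPowerSeries.constantCoeff_X]
    rw [zero_pow (by omega), mul_zero, zero_sub, neg_ne_zero]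
    refine mul_ne_zero (mul_ne_zero ?_ (mul_ne_zero hs ?_)) (pow_ne_zero _ hs)
    · exact_mod_cast (by omega : b + 2 ≠ 0)
    · exact_mod_cast (by omega : m + 1 ≠ 0)
  have hF2 : F = u * x ^ N + y *
      (-(MvPowerSeries.C ((b + 2 : ℕ) * (s * (m + 1 : ℕ)) : ℂ) * (c * x ^ m))) := by
    have e1 : P - 1 = b + 2 + N := by omega
    have e2 : N = (m + 1) * (b + 1) + m := by
      have : N + 1 = (m + 1) * (b + 1) + m + 1 := by rw [hN]; ring
      omega
    have e3 : g ^ (b + 1) = (MvPowerSeries.C s * x ^ (m + 1)) ^ (b + 1) + y * c := by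
      linear_combination hc
    have e4 : x ^ N = (x ^ (m + 1)) ^ (b + 1) * x ^ m := by
      rw [e2, pow_add, pow_mul]
    rw [hF, hu, e1, e3, pow_add, e4, map_mul _ _ (s ^ (b + 1)), map_pow, mul_pow]
    ring
  have hFy : Reg F y := by
    rw [hF2]; exact ((Reg.unit _ hu1).mul (reg_xy.pow _)).add_mul _
  have hDy : D F y = N := by
    rw [hF2, D_add_mul, D_unit_mul _ _ _ hu1, D_comm, D_pow _ _ (X_ne 0) reg_yx, D_comm, D_xy,
      mul_one]
  rw [D_mul_pow _ _ _ (X_ne 1) hFy, D_pow _ _ hg0 hFg, hDg, hDy]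
  have e5 : b + 2 - 1 = b + 1 := rfl
  simp only [Nat.add_sub_cancel, e5]
  push_cast
  rfl

end MilnorAux

/-- For `k ≥ 1`, `a ≥ 2`, `b ≥ 2` and `p = kab`, the family
`f_s = x^p - (y^a + s x^{ka-1})^b` deforming `f₀ = x^p - y^{ab}` satisfies
`μ(f₀) - μ(f_s) = ab - b` for all sufficiently small `s ≠ 0`. -/
theorem milnor_jump_ab_sub_b (k a b p : ℕ) (hk : 1 ≤ k) (ha : 2 ≤ a) (hb : 2 ≤ b)
    (hp : p = k * a * b) :
    ∃ ε > (0:ℝ), ∀ s : ℂ, s ≠ 0 → ‖s‖ < ε →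
      (milnor ((X 0) ^ p - (X 1) ^ (a * b)) : ℤ)
        - milnor ((X 0) ^ p - ((X 1) ^ a + C s * (X 0) ^ (k * a - 1)) ^ b)
        = (a : ℤ) * b - b := by
  refine ⟨1, one_pos, fun s hs _ => ?_⟩
  obtain ⟨m, hm⟩ : ∃ m, k * a = m + 1 :=
    ⟨k * a - 1, by have : 0 < k * a := by positivity
                   omega⟩
  have hm1 : 1 ≤ m := by nlinarith
  have hp' : p = m * b + b := by rw [hp, hm]; ring
  have hab : 1 ≤ a * b := Nat.mul_pos (by omega) (by omega)
  have hmb : 1 ≤ m * b := Nat.mul_pos (by omega) (by omega)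
  rw [hp', MilnorAux.milnor_zero _ _ (by omega) (by omega), hm, Nat.add_sub_cancel,
    MilnorAux.milnor_s m a b hm1 ha hb s hs]
  push_cast [Nat.cast_sub hab, Nat.cast_sub hmb, Nat.cast_sub (show 1 ≤ a by omega),
    Nat.cast_sub (show 1 ≤ b by omega), Nat.cast_sub (show 1 ≤ m * b + b by omega)]
  ring
end

section
/- The family f_s(x,y) = x⁴ − (y² + s x)² satisfies μ(f₀) − μ(f_s) = 2 for small s ≠ 0, where f₀ = x⁴ − y⁴; i.e., μ(x⁴ − (y² + s x)²) = 7 for small s ≠ 0 while μ(x⁴ − y⁴) = 9. -/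
open MvPolynomial

lemma finrank_aux {R : Type*} [CommRing R] [Algebra ℂ R] (J : Ideal R) {ι : Type*} [Fintype ι] (Φ : R →ₗ[ℂ] (ι → ℂ))
    (hs : Function.Surjective Φ) (hk : ∀ f, Φ f = 0 ↔ f ∈ J) : Module.finrank ℂ (R ⧸ J) = Fintype.card ι := by
  have h : LinearMap.ker Φ = J.restrictScalars ℂ := by ext f; simp [hk]
  have e := (Submodule.quotEquivOfEq _ _ h).symm.trans (Φ.quotKerEquivOfSurjective hs)
  have e2 := (Submodule.Quotient.restrictScalarsEquiv ℂ J).symm.trans e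
  rw [e2.finrank_eq]; simp

lemma mem_of_coeff (a b : ℕ) (f : MvPowerSeries (Fin 2) ℂ)
   (h : ∀ m : Fin 2 →₀ ℕ, m 0 < a → m 1 < b → MvPowerSeries.coeff m f = 0) :
   ∃ g k, f = (MvPowerSeries.X 0)^a * g + (MvPowerSeries.X 1)^b * k := by
  let f1 : MvPowerSeries (Fin 2) ℂ := fun m => if a ≤ m 0 then MvPowerSeries.coeff m f else 0
  have c1 : ∀ m, MvPowerSeries.coeff m f1 = if a ≤ m 0 then MvPowerSeries.coeff m f else 0 := fun _ => rfl
  obtain ⟨g, hg⟩ := (MvPowerSeries.X_pow_dvd_iff (s := 0) (n := a) (φ := f1)).2 (by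
    intro m hm; rw [c1, if_neg (by omega)])
  obtain ⟨k, hk⟩ := (MvPowerSeries.X_pow_dvd_iff (s := 1) (n := b) (φ := f - f1)).2 (by
    intro m hm; rw [map_sub, c1]; split_ifs with h1
    · simp
    · rw [h m (by omega) hm]; simp)
  exact ⟨g, k, by rw [← hg, ← hk]; ring⟩

lemma part1 : Module.finrank ℂ (MvPowerSeries (Fin 2) ℂ ⧸ (Ideal.span {(MvPowerSeries.X 0)^3, (MvPowerSeries.X 1)^3} : Ideal (MvPowerSeries (Fin 2) ℂ))) = 9 := by
  let Φ : MvPowerSeries (Fin 2) ℂ →ₗ[ℂ] (Fin 3 × Fin 3 → ℂ) :=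
    LinearMap.pi fun p => MvPowerSeries.coeff (Finsupp.equivFunOnFinite.symm ![(p.1:ℕ), (p.2:ℕ)])
  have := finrank_aux (Ideal.span {(MvPowerSeries.X 0)^3, (MvPowerSeries.X 1)^3}) Φ ?_ ?_
  · simpa using this
  · intro v
    refine ⟨fun m => if h : m 0 < 3 ∧ m 1 < 3 then v (⟨m 0, h.1⟩, ⟨m 1, h.2⟩) else 0, ?_⟩
    ext ⟨i, j⟩
    change (dite _ _ _) = _
    simp
  · intro f
    rw [Ideal.mem_span_pair]
    constructor
    · intro h
      obtain ⟨g, k, h⟩ := mem_of_coeff 3 3 f (by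
        intro m h0 h1
        have := congrFun h (⟨m 0, h0⟩, ⟨m 1, h1⟩)
        have e : m = Finsupp.equivFunOnFinite.symm ![m 0, m 1] := by
          ext i; fin_cases i <;> simp
        rw [e]; exact this)
      exact ⟨g, k, by rw [h]; ring⟩
    · rintro ⟨g, k, rfl⟩
      ext ⟨i, j⟩
      simp only [Φ, LinearMap.pi_apply, Pi.zero_apply]
      rw [map_add, mul_comm g, mul_comm k, MvPowerSeries.X_pow_dvd_iff.1 (Dvd.intro _ rfl), MvPowerSeries.X_pow_dvd_iff.1 (Dvd.intro _ rfl), add_zero]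
      · simp
      · simp

noncomputable def Jid (α β : ℂ) : Ideal (MvPowerSeries (Fin 2) ℂ) :=
  Ideal.span {(MvPowerSeries.X 1)^7, MvPowerSeries.X 0 -
    (MvPowerSeries.C α * (MvPowerSeries.X 1)^2 + MvPowerSeries.C β * (MvPowerSeries.X 1)^6)}

noncomputable def subv (α β : ℂ) : Fin 2 → PowerSeries ℂ :=
  ![PowerSeries.C α * PowerSeries.X^2 + PowerSeries.C β * PowerSeries.X^6, PowerSeries.X]

noncomputable def subp (α β : ℂ) : Fin 2 → Polynomial ℂ :=
  ![Polynomial.C α * Polynomial.X^2 + Polynomial.C β * Polynomial.X^6, Polynomial.X]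

lemma subv_has (α β : ℂ) : MvPowerSeries.HasSubst (subv α β) := by
  apply MvPowerSeries.hasSubst_of_constantCoeff_zero
  intro i
  change PowerSeries.constantCoeff _ = 0
  fin_cases i <;> simp [subv]

noncomputable def sub (α β : ℂ) : MvPowerSeries (Fin 2) ℂ →ₐ[ℂ] PowerSeries ℂ :=
  MvPowerSeries.substAlgHom (subv_has α β)

lemma sub_X (α β : ℂ) (i : Fin 2) : sub α β (MvPowerSeries.X i) = subv α β i :=
  MvPowerSeries.substAlgHom_X (subv_has α β) i

lemma sub_C (α β c : ℂ) : sub α β (MvPowerSeries.C c) = PowerSeries.C c :=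
  (sub α β).commutes c

lemma sub_coe (α β : ℂ) (q : MvPolynomial (Fin 2) ℂ) :
    sub α β (q : MvPowerSeries (Fin 2) ℂ) = ((aeval (subp α β) q : Polynomial ℂ) : PowerSeries ℂ) := by
  have : (sub α β).comp (MvPolynomial.coeToMvPowerSeries.algHom ℂ) =
      (Polynomial.coeToPowerSeries.algHom ℂ).comp (aeval (subp α β)) := by
    apply MvPolynomial.algHom_ext
    intro i
    fin_cases i <;> simp [sub_X, subv, subp]
  simpa using DFunLike.congr_fun this q

lemma mk_coe (α β : ℂ) (q : MvPolynomial (Fin 2) ℂ) :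
    (Ideal.Quotient.mkₐ ℂ (Jid α β)) (q : MvPowerSeries (Fin 2) ℂ) =
      Polynomial.aeval (Ideal.Quotient.mkₐ ℂ (Jid α β) (MvPowerSeries.X 1)) (aeval (subp α β) q) := by
  have : (Ideal.Quotient.mkₐ ℂ (Jid α β)).comp (MvPolynomial.coeToMvPowerSeries.algHom ℂ) =
      (Polynomial.aeval (Ideal.Quotient.mkₐ ℂ (Jid α β) (MvPowerSeries.X 1))).comp
        (aeval (subp α β)) := by
    apply MvPolynomial.algHom_ext
    intro i
    fin_cases i
    · simp only [AlgHom.comp_apply, subp]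
      simp
      rw [← sub_eq_zero]
      have h : MvPowerSeries.X 0 - (MvPowerSeries.C α * (MvPowerSeries.X 1)^2 + MvPowerSeries.C β * (MvPowerSeries.X 1)^6) ∈ Jid α β :=
        Ideal.subset_span (by simp)
      have h2 := Ideal.Quotient.eq_zero_iff_mem.2 h
      rw [← h2]
      simp
      rfl
    · simp [subp]
  simpa using DFunLike.congr_fun this q

lemma part2 (α β : ℂ) : Module.finrank ℂ (MvPowerSeries (Fin 2) ℂ ⧸ Jid α β) = 7 := by
  let Φ : MvPowerSeries (Fin 2) ℂ →ₗ[ℂ] (Fin 7 → ℂ) :=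
    LinearMap.pi fun p => (PowerSeries.coeff (p:ℕ)).comp (sub α β).toLinearMap
  have hΦ : ∀ f, Φ f = 0 ↔ PowerSeries.X ^ 7 ∣ sub α β f := by
    intro f
    rw [PowerSeries.X_pow_dvd_iff]
    constructor
    · intro h m hm
      exact congrFun h ⟨m, hm⟩
    · intro h
      ext i
      exact h i i.2
  have hy : (MvPowerSeries.X 1)^7 ∈ Jid α β := Ideal.subset_span (by simp)
  have hJ : ∀ f ∈ Jid α β, PowerSeries.X ^ 7 ∣ sub α β f := by
    intro f hf
    rw [Jid, Ideal.mem_span_pair] at hf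
    obtain ⟨a, b, rfl⟩ := hf
    simp only [map_add, map_sub, map_mul, map_pow, sub_X, sub_C]
    simp [subv]
  have := finrank_aux (Jid α β) Φ ?_ ?_
  · simpa using this
  · intro v
    refine ⟨∑ i, MvPowerSeries.C (v i) * (MvPowerSeries.X 1) ^ (i:ℕ), ?_⟩
    ext j
    simp only [Φ, LinearMap.pi_apply, LinearMap.comp_apply, AlgHom.toLinearMap_apply, map_sum, map_mul, map_pow, sub_X, sub_C]
    simp [subv, PowerSeries.coeff_X_pow, Fin.val_inj]
  · intro f
    rw [hΦ]
    constructor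
    · intro h
      let n : Fin 2 →₀ ℕ := Finsupp.equivFunOnFinite.symm ![6, 6]
      let q := MvPowerSeries.trunc' ℂ n f
      have hx : (MvPowerSeries.X 0)^7 ∈ Jid α β := by
        rw [Jid, Ideal.mem_span_pair]
        obtain ⟨c, hc⟩ := sub_dvd_pow_sub_pow (MvPowerSeries.X 0 : MvPowerSeries (Fin 2) ℂ)
          (MvPowerSeries.C α * (MvPowerSeries.X 1)^2 + MvPowerSeries.C β * (MvPowerSeries.X 1)^6) 7
        refine ⟨(MvPowerSeries.X 1)^7 * (MvPowerSeries.C α + MvPowerSeries.C β * (MvPowerSeries.X 1)^4)^7, c, ?_⟩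
        linear_combination -hc
      have hq : f - q ∈ Jid α β := by
        obtain ⟨g, k, h⟩ := mem_of_coeff 7 7 (f - q) (by
          intro m h0 h1
          rw [map_sub, MvPolynomial.coeff_coe, MvPowerSeries.coeff_trunc', if_pos, sub_self]
          intro i
          fin_cases i
          · simp [n]; omega
          · simp [n]; omega)
        rw [h]
        exact Ideal.add_mem _ (Ideal.mul_mem_right _ _ hx) (Ideal.mul_mem_right _ _ hy)
      have hfwd : PowerSeries.X ^ 7 ∣ sub α β (f - q) := hJ _ hq
      have hq2 : PowerSeries.X ^ 7 ∣ sub α β q := by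
        have := dvd_sub h hfwd
        simpa using this
      rw [sub_coe, PowerSeries.X_pow_dvd_iff] at hq2
      simp only [Polynomial.coeff_coe] at hq2
      obtain ⟨r, hr⟩ := Polynomial.X_pow_dvd_iff.2 hq2
      have hq3 : (q : MvPowerSeries (Fin 2) ℂ) ∈ Jid α β := by
        rw [← Ideal.Quotient.eq_zero_iff_mem]
        have := mk_coe α β q
        rw [hr, map_mul, map_pow, Polynomial.aeval_X, ← map_pow, Ideal.Quotient.mkₐ_eq_mk,
          Ideal.Quotient.eq_zero_iff_mem.2 hy, zero_mul] at this
        exact this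
      simpa using Ideal.add_mem _ hq hq3
    · exact hJ f

lemma ideal1 : milnor ((X 0) ^ 4 - (X 1) ^ 4) = 9 := by
  rw [milnor, ← part1]
  have h : (Ideal.span {((pderiv 0 ((X 0) ^ 4 - (X 1) ^ 4) : MvPolynomial (Fin 2) ℂ) : MvPowerSeries (Fin 2) ℂ),
      ((pderiv 1 ((X 0) ^ 4 - (X 1) ^ 4) : MvPolynomial (Fin 2) ℂ) : MvPowerSeries (Fin 2) ℂ)}) =
      Ideal.span {(MvPowerSeries.X 0)^3, (MvPowerSeries.X 1)^3} := by
    have h0 : ((pderiv 0 ((X 0) ^ 4 - (X 1) ^ 4) : MvPolynomial (Fin 2) ℂ) : MvPowerSeries (Fin 2) ℂ)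
        = MvPowerSeries.C 4 * (MvPowerSeries.X 0)^3 := by
      have h : (pderiv 0 ((X 0) ^ 4 - (X 1) ^ 4) : MvPolynomial (Fin 2) ℂ) = C 4 * X 0 ^ 3 := by
        rw [map_ofNat]
        simp [pderiv_X]
      rw [h]
      rw [← coeToMvPowerSeries.ringHom_apply]
      simp only [map_neg, map_mul, map_pow, coeToMvPowerSeries.ringHom_apply, coe_X, coe_C]
    have h1 : ((pderiv 1 ((X 0) ^ 4 - (X 1) ^ 4) : MvPolynomial (Fin 2) ℂ) : MvPowerSeries (Fin 2) ℂ)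
        = - (MvPowerSeries.C 4 * (MvPowerSeries.X 1)^3) := by
      have h : (pderiv 1 ((X 0) ^ 4 - (X 1) ^ 4) : MvPolynomial (Fin 2) ℂ) = -(C 4 * X 1 ^ 3) := by
        rw [map_ofNat]
        simp [pderiv_X]
      rw [h]
      rw [← coeToMvPowerSeries.ringHom_apply]
      simp only [map_neg, map_mul, map_pow, coeToMvPowerSeries.ringHom_apply, coe_X, coe_C]
    rw [h0, h1]
    have hc : (MvPowerSeries.C (4⁻¹ : ℂ) : MvPowerSeries (Fin 2) ℂ) * MvPowerSeries.C 4 = 1 := by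
      rw [← map_mul]; norm_num
    apply le_antisymm
    · rw [Ideal.span_le]
      rintro z (rfl | rfl) <;> simp only [SetLike.mem_coe, Ideal.mem_span_pair]
      · exact ⟨MvPowerSeries.C 4, 0, by ring⟩
      · exact ⟨0, -MvPowerSeries.C 4, by ring⟩
    · rw [Ideal.span_le]
      rintro z (rfl | rfl) <;> simp only [SetLike.mem_coe, Ideal.mem_span_pair]
      · exact ⟨MvPowerSeries.C 4⁻¹, 0, by linear_combination hc * (MvPowerSeries.X 0)^3⟩
      · exact ⟨0, -MvPowerSeries.C 4⁻¹, by linear_combination hc * (MvPowerSeries.X 1)^3⟩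
  rw [h]

/-- Relations in the Jacobian algebra, in abstract form. -/
lemma jac_rel {A : Type*} [CommRing A] (x y s t w : A) (hst : s * t = 1) (hw : w * 2 = 1)
    (hu : IsUnit (s ^ 4 - 2 * (y ^ 2 + s * x) ^ 2))
    (e1 : 4 * x ^ 3 - 2 * s * (y ^ 2 + s * x) = 0) (e2 : -(4 * y * (y ^ 2 + s * x)) = 0) :
    y ^ 7 = 0 ∧ x - (-t * y ^ 2 + -2 * t ^ 5 * y ^ 6) = 0 := by
  obtain ⟨u, hu'⟩ : ∃ u, u = y ^ 2 + s * x := ⟨_, rfl⟩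
  rw [← hu'] at hu e1 e2
  have f2 : y * u = 0 := by
    linear_combination -w ^ 2 * e2 - (y * u) * (1 + w * 2) * hw
  have f1 : 2 * x ^ 3 = s * u := by
    linear_combination w * e1 - (2 * x ^ 3 - s * u) * hw
  have f3 : s ^ 4 * u = 2 * u ^ 3 - 2 * y ^ 6 := by
    have : s * x = u - y ^ 2 := by rw [hu']; ring
    have h3 : (s * x) ^ 3 = (u - y ^ 2) ^ 3 := by rw [this]
    linear_combination 2 * h3 - s ^ 3 * f1 + (- 6 * u * y + 6 * y ^ 3) * f2
  constructor
  · have f4 : 2 * y ^ 7 = 0 := by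
      linear_combination y * f3 + (2 * u ^ 2 - s ^ 4) * f2
    linear_combination w * f4 - y ^ 7 * hw
  · have f5 : u ^ 2 = 0 := by
      rw [← hu.mul_right_eq_zero]
      linear_combination u * f3 - 2 * y ^ 5 * f2
    have hts : t ^ 5 * s ^ 5 = 1 := by rw [← mul_pow, mul_comm t, hst, one_pow]
    have f6 : s ^ 4 * u = - 2 * y ^ 6 := by linear_combination f3 + 2 * u * f5
    have hx : x = t * u - t * y ^ 2 := by rw [hu']; linear_combination -x * hst
    rw [hx]
    have f7 : t ^ 5 * s ^ 4 = t := by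
      have : t ^ 4 * s ^ 4 = 1 := by rw [← mul_pow, mul_comm t, hst, one_pow]
      linear_combination t * this
    linear_combination t ^ 5 * f6 - u * f7

/-- Pure algebra: the two ideals agree. -/
lemma ideal_eq {R : Type*} [CommRing R] (x y s t w : R) (hst : s * t = 1) (hw : w * 2 = 1)
    (hu : IsUnit (s ^ 4 - 2 * (y ^ 2 + s * x) ^ 2)) :
    Ideal.span {4 * x ^ 3 - 2 * s * (y ^ 2 + s * x), -(4 * y * (y ^ 2 + s * x))} =
      Ideal.span {y ^ 7, x - (-t * y ^ 2 + -2 * t ^ 5 * y ^ 6)} := by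
  apply le_antisymm
  · rw [Ideal.span_le]
    set J := Ideal.span {y ^ 7, x - (-t * y ^ 2 + -2 * t ^ 5 * y ^ 6)}
    have e1 : y ^ 7 ∈ J := Ideal.subset_span (by simp)
    have e2 : x - (-t * y ^ 2 + -2 * t ^ 5 * y ^ 6) ∈ J := Ideal.subset_span (by simp)
    rw [← Ideal.Quotient.eq_zero_iff_mem] at e1 e2
    rintro z (rfl | rfl) <;> rw [SetLike.mem_coe, ← Ideal.Quotient.eq_zero_iff_mem] <;>
      replace hst := congrArg (Ideal.Quotient.mk J) hst <;>
      simp only [map_sub, map_mul, map_pow, map_add, map_neg, map_ofNat, map_one] at * <;>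
      generalize Ideal.Quotient.mk J x = x at * <;>
      generalize Ideal.Quotient.mk J y = y at * <;>
      generalize Ideal.Quotient.mk J s = s at * <;>
      generalize Ideal.Quotient.mk J t = t at *
    · have hx : x = -t * y ^ 2 + -2 * t ^ 5 * y ^ 6 := by linear_combination e2
      have hu : y ^ 2 + s * x = -2 * t ^ 4 * y ^ 6 := by
        rw [hx]; linear_combination (-y ^ 2 - 2 * t ^ 4 * y ^ 6) * hst
      have hx3 : x ^ 3 = - t ^ 3 * y ^ 6 := by
        rw [hx]
        linear_combination (-(6 * t ^ 7 * y ^ 3) - 12 * t ^ 11 * y ^ 7 - 8 * t ^ 15 * y ^ 11) * e1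
      rw [hu, hx3]
      linear_combination 4 * t ^ 3 * y ^ 6 * hst
    · have hx : x = -t * y ^ 2 + -2 * t ^ 5 * y ^ 6 := by linear_combination e2
      have hu : y ^ 2 + s * x = -2 * t ^ 4 * y ^ 6 := by
        rw [hx]; linear_combination (-y ^ 2 - 2 * t ^ 4 * y ^ 6) * hst
      rw [hu]
      linear_combination 8 * t ^ 4 * e1
  · rw [Ideal.span_le]
    set J := Ideal.span {4 * x ^ 3 - 2 * s * (y ^ 2 + s * x), -(4 * y * (y ^ 2 + s * x))}
    have e1 : 4 * x ^ 3 - 2 * s * (y ^ 2 + s * x) ∈ J := Ideal.subset_span (by simp)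
    have e2 : -(4 * y * (y ^ 2 + s * x)) ∈ J := Ideal.subset_span (by simp)
    rw [← Ideal.Quotient.eq_zero_iff_mem] at e1 e2
    replace hu := hu.map (Ideal.Quotient.mk J)
    rintro z (rfl | rfl) <;> rw [SetLike.mem_coe, ← Ideal.Quotient.eq_zero_iff_mem] <;>
      replace hst := congrArg (Ideal.Quotient.mk J) hst <;>
      replace hw := congrArg (Ideal.Quotient.mk J) hw <;>
      simp only [map_sub, map_mul, map_pow, map_add, map_neg, map_ofNat, map_one] at * <;>
      generalize Ideal.Quotient.mk J x = x at * <;>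
      generalize Ideal.Quotient.mk J y = y at * <;>
      generalize Ideal.Quotient.mk J s = s at * <;>
      generalize Ideal.Quotient.mk J w = w at * <;>
      generalize Ideal.Quotient.mk J t = t at *
    · exact (jac_rel x y s t w hst hw hu e1 e2).1
    · exact (jac_rel x y s t w hst hw hu e1 e2).2

lemma ideal2 (s : ℂ) (hs : s ≠ 0) : milnor ((X 0) ^ 4 - ((X 1) ^ 2 + C s * X 0) ^ 2) = 7 := by
  have h0 : ((pderiv 0 ((X 0) ^ 4 - ((X 1) ^ 2 + C s * X 0) ^ 2) : MvPolynomial (Fin 2) ℂ) : MvPowerSeries (Fin 2) ℂ)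
      = 4 * (MvPowerSeries.X 0)^3 - 2 * MvPowerSeries.C s * ((MvPowerSeries.X 1) ^ 2 + MvPowerSeries.C s * MvPowerSeries.X 0) := by
    have h : (pderiv 0 ((X 0) ^ 4 - ((X 1) ^ 2 + C s * X 0) ^ 2) : MvPolynomial (Fin 2) ℂ) =
        4 * X 0 ^ 3 - 2 * C s * (X 1 ^ 2 + C s * X 0) := by
      simp [pderiv_X]
      ring
    rw [h]
    rw [← coeToMvPowerSeries.ringHom_apply]
    simp only [map_neg, map_sub, map_add, map_mul, map_pow, map_ofNat, coeToMvPowerSeries.ringHom_apply, coe_X, coe_C]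
  have h1 : ((pderiv 1 ((X 0) ^ 4 - ((X 1) ^ 2 + C s * X 0) ^ 2) : MvPolynomial (Fin 2) ℂ) : MvPowerSeries (Fin 2) ℂ)
      = -(4 * MvPowerSeries.X 1 * ((MvPowerSeries.X 1) ^ 2 + MvPowerSeries.C s * MvPowerSeries.X 0)) := by
    have h : (pderiv 1 ((X 0) ^ 4 - ((X 1) ^ 2 + C s * X 0) ^ 2) : MvPolynomial (Fin 2) ℂ) =
        -(4 * X 1 * (X 1 ^ 2 + C s * X 0)) := by
      simp [pderiv_X]
      ring
    rw [h]
    rw [← coeToMvPowerSeries.ringHom_apply]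
    simp only [map_neg, map_sub, map_add, map_mul, map_pow, map_ofNat, coeToMvPowerSeries.ringHom_apply, coe_X, coe_C]
  rw [milnor, h0, h1, ideal_eq _ _ (MvPowerSeries.C s) (MvPowerSeries.C s⁻¹) (MvPowerSeries.C 2⁻¹)]
  · have := part2 (-s⁻¹) (-2 * s⁻¹ ^ 5)
    have c1 : (MvPowerSeries.C (-s⁻¹) : MvPowerSeries (Fin 2) ℂ) = -MvPowerSeries.C s⁻¹ := map_neg _ _
    have c2 : (MvPowerSeries.C (-2 * s⁻¹ ^ 5) : MvPowerSeries (Fin 2) ℂ) =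
        -2 * MvPowerSeries.C s⁻¹ ^ 5 := by
      rw [map_mul, map_pow, map_neg, map_ofNat]
    rw [Jid, c1, c2] at this
    exact this
  · rw [← map_mul, mul_inv_cancel₀ hs, map_one]
  · rw [← map_ofNat (MvPowerSeries.C (σ := Fin 2) (R := ℂ)) 2, ← map_mul]; norm_num
  · rw [MvPowerSeries.isUnit_iff_constantCoeff]
    simp [hs]

/-- The degenerate family `f_s = x⁴ - (y² + sx)²` deforming `f₀ = x⁴ - y⁴` satisfies
`μ(f₀) = 9` and `μ(f_s) = 7` for all sufficiently small `s ≠ 0`, so the jump is `2`. -/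
theorem milnor_jump_degenerate_family :
    milnor ((X 0) ^ 4 - (X 1) ^ 4) = 9 ∧
    ∃ ε > (0:ℝ), ∀ s : ℂ, s ≠ 0 → ‖s‖ < ε →
      milnor ((X 0) ^ 4 - ((X 1) ^ 2 + C s * X 0) ^ 2) = 7 := by
  exact ⟨ideal1, 1, one_pos, fun s hs _ => ideal2 s hs⟩
end
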